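/- arXiv:1705.01199 — 2 statements merged into one kernel-verified Lean document; each statement's English description precedes it below -/
import Mathlib

section
/- Suppose G is a multigraph with no isolated vertices, G_0, G_1, …, G_m is a minimal chain decomposition of G rooted at r, and v ≠ r is a vertex of G. Then there exist indices i and j such that v has degree exactly two in H_i and degree exactly two in Hbar_j. -/
set_option autoImplicit false

/-- A multigraph: a type of vertices, a type of edges, and a map assigning to each
edge its unordered pair of endpoints (a loop has endpoints `s(v, v)`). -/
structure MG : Type 1 where
  V : Type
  E : Type
  ends : E → Sym2 V

namespace MG

variable (G : MG)

/-- The set of vertices covered by a set `F` of edges. -/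
def vertsOf (F : Set G.E) : Set G.V := {v | ∃ e ∈ F, v ∈ G.ends e}

/-- The degree of a vertex `v` with respect to a set `F` of edges;
a loop contributes two to the degree. -/
noncomputable def deg (F : Set G.E) (v : G.V) : ℕ :=
  {e ∈ F | v ∈ G.ends e}.ncard + {e ∈ F | G.ends e = s(v, v)}.ncard

/-- `G` has no isolated vertices. -/
def NoIsolated : Prop := ∀ v : G.V, ∃ e : G.E, v ∈ G.ends e

/-- `IsLink vs es`: the edge list `es` successively links the consecutive
vertices of the vertex list `vs`. -/
def IsLink : List G.V → List G.E → Prop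
  | [_], [] => True
  | a :: b :: vs, e :: es => G.ends e = s(a, b) ∧ IsLink (b :: vs) es
  | _, _ => False

/-- `vs, es` form a (simple) path: distinct vertices, distinct edges, consecutive linking. -/
def IsPath (vs : List G.V) (es : List G.E) : Prop :=
  vs.Nodup ∧ es.Nodup ∧ G.IsLink vs es

/-- `v :: vs, es` form a (simple) cycle through the basepoint `v`:
the distinct vertices `v :: vs` are linked cyclically by the distinct edges `es`.
A loop gives a cycle of length one and two parallel edges give a cycle of length two. -/
def IsCycle (v : G.V) (vs : List G.V) (es : List G.E) : Prop :=
  (v :: vs).Nodup ∧ es.Nodup ∧ es ≠ [] ∧ G.IsLink (v :: (vs ++ [v])) es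

/-- Reachability using only edges from `F`. -/
def Reach (F : Set G.E) : G.V → G.V → Prop :=
  Relation.ReflTransGen (fun a b => ∃ e ∈ F, G.ends e = s(a, b))

/-- `G` with edge set restricted to `F` is connected as a graph on all of `G.V`. -/
def ConnectedOn (F : Set G.E) : Prop := ∀ a b : G.V, G.Reach F a b

/-- The subgraph formed by the edge set `F` together with the vertices it covers
is connected. -/
def ConnectedWithin (F : Set G.E) : Prop :=
  ∀ a ∈ G.vertsOf F, ∀ b ∈ G.vertsOf F, G.Reach F a b

/-- `G` is 4-edge-connected: at least two vertices, and deleting any set of fewer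
than four edges leaves the graph connected. -/
def FourEdgeConnected : Prop :=
  2 ≤ Nat.card G.V ∧ ∀ S : Set G.E, S.Finite → S.ncard < 4 → G.ConnectedOn Sᶜ

/-- `e` is a cut edge of the subgraph formed by the edge set `F`: removing `e`
disconnects two vertices of that subgraph. -/
def IsCutEdge (F : Set G.E) (e : G.E) : Prop :=
  e ∈ F ∧ ∃ a ∈ G.vertsOf F, ∃ b ∈ G.vertsOf F, ¬ G.Reach (F \ {e}) a b

/-! ### Chains -/

/-- An open up chain with respect to `(H, Hb)`, rooted at `r`: a path with at least
one edge, edge-disjoint from `H` and `Hb`, in which every vertex is `r` or has degree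
at least two in `Hb`, and whose ends are `r` or lie in `H`. -/
def IsOpenUpChain (r : G.V) (H Hb C : Set G.E) : Prop :=
  Disjoint C H ∧ Disjoint C Hb ∧
  ∃ vs es, G.IsPath vs es ∧ es ≠ [] ∧ C = {e | e ∈ es} ∧
    (∀ v ∈ vs, v = r ∨ 2 ≤ G.deg Hb v) ∧
    (∀ v, vs.head? = some v → v = r ∨ v ∈ G.vertsOf H) ∧
    (∀ v, vs.getLast? = some v → v = r ∨ v ∈ G.vertsOf H)

/-- A closed up chain with respect to `(H, Hb)`, rooted at `r`, with common end `v`: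
a cycle through `v`, edge-disjoint from `H` and `Hb`, in which every vertex is `r` or
has degree at least two in `Hb`, and the end `v` is `r` or has degree at least two in `H`. -/
def IsClosedUpChain (r : G.V) (H Hb C : Set G.E) (v : G.V) : Prop :=
  Disjoint C H ∧ Disjoint C Hb ∧
  ∃ vs es, G.IsCycle v vs es ∧ C = {e | e ∈ es} ∧
    (∀ u ∈ v :: vs, u = r ∨ 2 ≤ G.deg Hb u) ∧
    (v = r ∨ 2 ≤ G.deg H v)

/-- An up chain with respect to `(H, Hb)`. -/
def IsUpChain (r : G.V) (H Hb C : Set G.E) : Prop :=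
  G.IsOpenUpChain r H Hb C ∨ ∃ v, G.IsClosedUpChain r H Hb C v

/-- A down chain with respect to `(H, Hb)` is an up chain with respect to `(Hb, H)`. -/
def IsDownChain (r : G.V) (H Hb C : Set G.E) : Prop := G.IsUpChain r Hb H C

/-- A closed down chain with respect to `(H, Hb)` with common end `v`. -/
def IsClosedDownChain (r : G.V) (H Hb C : Set G.E) (v : G.V) : Prop :=
  G.IsClosedUpChain r Hb H C v

/-- A one-way chain with respect to `(H, Hb)`, with tail `u` and head `v`:
a single edge `e ∉ H ∪ Hb` with ends `u` and `v`, where the tail `u` is `r` or has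
degree at least two in `H`, and the head `v` is `r` or has degree at least two in `Hb`. -/
def IsOneWayChainAt (r : G.V) (H Hb C : Set G.E) (u v : G.V) : Prop :=
  ∃ e, e ∉ H ∧ e ∉ Hb ∧ C = {e} ∧ G.ends e = s(u, v) ∧
    (u = r ∨ 2 ≤ G.deg H u) ∧ (v = r ∨ 2 ≤ G.deg Hb v)

/-- A one-way chain with respect to `(H, Hb)`. -/
def IsOneWayChain (r : G.V) (H Hb C : Set G.E) : Prop :=
  ∃ u v, G.IsOneWayChainAt r H Hb C u v

/-- A chain with respect to `(H, Hb)`: an up chain, a down chain, or a one-way chain. -/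
def IsChain (r : G.V) (H Hb C : Set G.E) : Prop :=
  G.IsUpChain r H Hb C ∨ G.IsDownChain r H Hb C ∨ G.IsOneWayChain r H Hb C

/-- `H_i`: the union of the chains with index `< i`. -/
def before {n : ℕ} (Gs : Fin n → Set G.E) (i : Fin n) : Set G.E :=
  {e | ∃ j, j < i ∧ e ∈ Gs j}

/-- `Hbar_i`: the union of the chains with index `> i`. -/
def after {n : ℕ} (Gs : Fin n → Set G.E) (i : Fin n) : Set G.E :=
  {e | ∃ j, i < j ∧ e ∈ Gs j}

/-- `Gs` is a chain decomposition, rooted at `r`, of the part of `G` with edge set `F`: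
the `Gs i` partition `F`, and each `Gs i` is an up chain, a down chain or a one-way
chain with respect to `(H_i, Hbar_i)`. -/
def IsChainDecompOn (F : Set G.E) (r : G.V) {n : ℕ} (Gs : Fin n → Set G.E) : Prop :=
  (∀ i j, i ≠ j → Disjoint (Gs i) (Gs j)) ∧ (⋃ i, Gs i) = F ∧
  ∀ i, G.IsChain r (G.before Gs i) (G.after Gs i) (Gs i)

/-- `Gs` is a chain decomposition of `G` rooted at `r`. -/
def IsChainDecomp (r : G.V) {n : ℕ} (Gs : Fin n → Set G.E) : Prop :=
  G.IsChainDecompOn Set.univ r Gs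

/-- `G` has a chain decomposition rooted at `r`. -/
def HasChainDecomp (r : G.V) : Prop :=
  ∃ (m : ℕ) (Gs : Fin (m + 1) → Set G.E), G.IsChainDecomp r Gs

/-- A minimal open up chain: an open up chain none of whose internal vertices
lies in `{r} ∪ V(H)`. -/
def IsMinimalOpenUpChain (r : G.V) (H Hb C : Set G.E) : Prop :=
  Disjoint C H ∧ Disjoint C Hb ∧
  ∃ vs es, G.IsPath vs es ∧ es ≠ [] ∧ C = {e | e ∈ es} ∧
    (∀ v ∈ vs, v = r ∨ 2 ≤ G.deg Hb v) ∧
    (∀ v, vs.head? = some v → v = r ∨ v ∈ G.vertsOf H) ∧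
    (∀ v, vs.getLast? = some v → v = r ∨ v ∈ G.vertsOf H) ∧
    (∀ v ∈ vs, vs.head? ≠ some v → vs.getLast? ≠ some v → v ≠ r ∧ v ∉ G.vertsOf H)

/-- A minimal up chain: an up chain none of whose internal vertices lies in
`{r} ∪ V(H)`. -/
def IsMinimalUpChain (r : G.V) (H Hb C : Set G.E) : Prop :=
  G.IsMinimalOpenUpChain r H Hb C ∨
  ∃ v, G.IsClosedUpChain r H Hb C v ∧
    ∀ u ∈ G.vertsOf C, u ≠ v → u ≠ r ∧ u ∉ G.vertsOf H

/-- A minimal down chain: a down chain none of whose internal vertices lies in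
`{r} ∪ V(Hb)`. -/
def IsMinimalDownChain (r : G.V) (H Hb C : Set G.E) : Prop :=
  G.IsMinimalUpChain r Hb H C

/-- A minimal chain decomposition (of the part of `G` with edge set `F`):
a chain decomposition all of whose up chains and down chains are minimal. -/
def IsMinimalChainDecompOn (F : Set G.E) (r : G.V) {n : ℕ} (Gs : Fin n → Set G.E) : Prop :=
  G.IsChainDecompOn F r Gs ∧
  ∀ i, G.IsMinimalUpChain r (G.before Gs i) (G.after Gs i) (Gs i) ∨
       G.IsMinimalDownChain r (G.before Gs i) (G.after Gs i) (Gs i) ∨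
       G.IsOneWayChain r (G.before Gs i) (G.after Gs i) (Gs i)

/-- A minimal chain decomposition of `G` rooted at `r`. -/
def IsMinimalChainDecomp (r : G.V) {n : ℕ} (Gs : Fin n → Set G.E) : Prop :=
  G.IsMinimalChainDecompOn Set.univ r Gs

/-! ### Subgraphs, trees and edge-independence -/

/-- A subgraph of `G`: a set of vertices together with a set of edges all of whose
endpoints lie in the vertex set. -/
structure Sub (G : MG) where
  verts : Set G.V
  edges : Set G.E
  valid : ∀ e ∈ edges, ∀ v ∈ G.ends e, v ∈ verts

/-- A subgraph is connected. -/
def Sub.Connected {G : MG} (T : Sub G) : Prop :=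
  T.verts.Nonempty ∧ ∀ a ∈ T.verts, ∀ b ∈ T.verts,
    Relation.ReflTransGen (fun x y => ∃ e ∈ T.edges, G.ends e = s(x, y)) a b

/-- A subgraph is a tree: connected and containing no cycle. -/
def Sub.IsTree {G : MG} (T : Sub G) : Prop :=
  T.Connected ∧ ¬ ∃ v vs es, G.IsCycle v vs es ∧ ∀ e ∈ es, e ∈ T.edges

/-- A subgraph is spanning. -/
def Sub.Spanning {G : MG} (T : Sub G) : Prop := T.verts = Set.univ

/-- `vs, es` is a path from `a` to `b` all of whose edges lie in the subgraph `T`. -/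
def Sub.PathIn {G : MG} (T : Sub G) (a b : G.V) (vs : List G.V) (es : List G.E) : Prop :=
  G.IsPath vs es ∧ vs.head? = some a ∧ vs.getLast? = some b ∧ ∀ e ∈ es, e ∈ T.edges

/-- Two subtrees of `G` are edge-independent with root `r`: each contains `r`, and for
every common vertex `v`, the path between `r` and `v` in one tree is edge-disjoint from
the path between `r` and `v` in the other. -/
def EdgeIndependent (r : G.V) (T₁ T₂ : Sub G) : Prop :=
  r ∈ T₁.verts ∧ r ∈ T₂.verts ∧
  ∀ v ∈ T₁.verts ∩ T₂.verts, ∀ vs₁ es₁ vs₂ es₂,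
    T₁.PathIn r v vs₁ es₁ → T₂.PathIn r v vs₂ es₂ → ∀ e ∈ es₁, e ∉ es₂

/-- `G` has a set of four edge-independent spanning trees rooted at `r`. -/
def HasFourEIST (r : G.V) : Prop :=
  ∃ T : Fin 4 → Sub G, (∀ i, (T i).IsTree ∧ (T i).Spanning) ∧
    ∀ i j, i ≠ j → G.EdgeIndependent r (T i) (T j)

/-! ### Mader operations -/

/-- Add to `G` a new edge with the (not necessarily distinct) endpoints `p`. -/
def addEdge (p : Sym2 G.V) : MG :=
  ⟨G.V, Option G.E, fun e => e.elim p G.ends⟩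

/-- Pinch the two distinct edges `e₁` (with ends `x`, `y`) and `e₂` (with ends `z`, `w`):
delete `e₁` and `e₂`, add a new vertex (`none`), and add four new edges joining the new
vertex to `x`, `y`, `z`, `w` respectively. -/
def pinch (e₁ e₂ : G.E) (x y z w : G.V) : MG where
  V := Option G.V
  E := {e : G.E // e ≠ e₁ ∧ e ≠ e₂} ⊕ Fin 4
  ends := fun e =>
    Sum.elim (fun e' => (G.ends e'.1).map some)
      (fun i =>
        if i = 0 then s((none : Option G.V), some x)
        else if i = 1 then s((none : Option G.V), some y)
        else if i = 2 then s((none : Option G.V), some z)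
        else s((none : Option G.V), some w)) e

end MG

/-- A multigraph with a distinguished root vertex. -/
structure PMG : Type 1 where
  G : MG
  r : G.V

/-- A single Mader operation on a rooted multigraph: either add an edge, or pinch two
distinct edges. -/
inductive MaderStep : PMG → PMG → Prop
  | addEdge (P : PMG) (p : Sym2 P.G.V) : MaderStep P ⟨P.G.addEdge p, P.r⟩
  | pinch (P : PMG) (e₁ e₂ : P.G.E) (x y z w : P.G.V) (hne : e₁ ≠ e₂)
      (h₁ : P.G.ends e₁ = s(x, y)) (h₂ : P.G.ends e₂ = s(z, w)) :
      MaderStep P ⟨P.G.pinch e₁ e₂ x y z w, some P.r⟩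

/-- The starting graph `G⁰` of the Mader construction: two vertices joined by four
parallel edges, rooted at one of them. -/
def basePMG : PMG :=
  ⟨⟨Bool, Fin 4, fun _ => s(false, true)⟩, false⟩

/-- An isomorphism of rooted multigraphs: bijections on vertices and edges commuting
with the endpoint maps and sending root to root. -/
def PIso (P Q : PMG) : Prop :=
  ∃ (fV : P.G.V ≃ Q.G.V) (fE : P.G.E ≃ Q.G.E),
    (∀ e, Q.G.ends (fE e) = (P.G.ends e).map fV) ∧ fV P.r = Q.r

/-- `G`, rooted at `r`, can be built from `basePMG` by repeatedly performing
Mader operations. -/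
def MaderConstructible (G : MG) (r : G.V) : Prop :=
  ∃ Q : PMG, Relation.ReflTransGen MaderStep basePMG Q ∧ PIso Q ⟨G, r⟩

namespace MG

variable {G : MG}

section ListDegree

open Classical

/-- The degree of `x` in a list of edges, counted with multiplicity. -/
noncomputable def listDeg (G : MG) (es : List G.E) (x : G.V) : ℕ :=
  es.countP (fun e => decide (x ∈ G.ends e)) + es.countP (fun e => decide (G.ends e = s(x, x)))

lemma ncard_sep_mem_list_le {α : Type} (l : List α) (p : α → Prop) [DecidablePred p] :
    {e ∈ {e | e ∈ l} | p e}.ncard ≤ l.countP (fun e => decide (p e)) := by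
  have hset : {e ∈ {e | e ∈ l} | p e} = ((l.filter (fun e => decide (p e))).toFinset : Set α) := by
    ext e
    simp
  rw [hset, Set.ncard_coe_finset, List.countP_eq_length_filter]
  exact List.toFinset_card_le _

lemma deg_setOf_mem_list_le (es : List G.E) (x : G.V) :
    G.deg {e | e ∈ es} x ≤ G.listDeg es x :=
  Nat.add_le_add (ncard_sep_mem_list_le es (fun e => x ∈ G.ends e))
    (ncard_sep_mem_list_le es (fun e => G.ends e = s(x, x)))

lemma IsLink.listDeg_add (x : G.V) :
    ∀ (vs : List G.V) (es : List G.E), G.IsLink vs es →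
      G.listDeg es x + (if vs.head? = some x then 1 else 0) +
        (if vs.getLast? = some x then 1 else 0) = 2 * vs.count x
  | [], _, h => by simp [IsLink] at h
  | [a], [], _ => by
    by_cases hax : a = x <;> simp [listDeg, hax]
  | [_], _ :: _, h => by simp [IsLink] at h
  | _ :: _ :: _, [], h => by simp [IsLink] at h
  | a :: b :: vs, e :: es, h => by
    obtain ⟨he, hl⟩ := h
    have ih := IsLink.listDeg_add x (b :: vs) es hl
    have hmem : x ∈ G.ends e ↔ x = a ∨ x = b := by rw [he, Sym2.mem_iff]
    have hloop : G.ends e = s(x, x) ↔ a = x ∧ b = x := by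
      rw [he, Sym2.eq_iff]; tauto
    simp only [listDeg, List.countP_cons, List.count_cons, List.head?_cons, hmem, hloop,
      List.getLast?_cons_cons, Option.some.injEq, decide_eq_true_eq, beq_iff_eq] at ih ⊢
    by_cases hax : a = x <;> by_cases hbx : b = x <;>
      simp [hax, hbx, eq_comm (a := x)] at ih ⊢ <;> omega

end ListDegree

lemma IsPath.deg_le_two {vs : List G.V} {es : List G.E} (h : G.IsPath vs es) (x : G.V) :
    G.deg {e | e ∈ es} x ≤ 2 := by
  classical
  have h1 := h.2.2.listDeg_add x
  have h2 := List.nodup_iff_count_le_one.mp h.1 x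
  have h3 := deg_setOf_mem_list_le es x
  omega

lemma IsPath.deg_end_le_one {vs : List G.V} {es : List G.E} (h : G.IsPath vs es) {x : G.V}
    (hx : vs.head? = some x ∨ vs.getLast? = some x) :
    G.deg {e | e ∈ es} x ≤ 1 := by
  classical
  have h1 := h.2.2.listDeg_add x
  have h2 := List.nodup_iff_count_le_one.mp h.1 x
  have h3 := deg_setOf_mem_list_le es x
  rcases hx with hx | hx <;> rw [if_pos hx] at h1 <;> omega

lemma IsLink.mem_of_deg_pos {vs : List G.V} {es : List G.E} (h : G.IsLink vs es) {x : G.V}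
    (hx : 0 < G.deg {e | e ∈ es} x) : x ∈ vs := by
  classical
  by_contra hmem
  have h1 := h.listDeg_add x
  rw [List.count_eq_zero_of_not_mem hmem] at h1
  have h3 := deg_setOf_mem_list_le es x
  omega

lemma IsCycle.mem_of_deg_pos {u : G.V} {vs : List G.V} {es : List G.E} (h : G.IsCycle u vs es)
    {x : G.V} (hx : 0 < G.deg {e | e ∈ es} x) : x ∈ u :: vs := by
  have := h.2.2.2.mem_of_deg_pos hx
  simpa [or_comm, or_left_comm] using this

lemma IsCycle.deg_le_two {u : G.V} {vs : List G.V} {es : List G.E} (h : G.IsCycle u vs es)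
    {x : G.V} (hx : x ≠ u) : G.deg {e | e ∈ es} x ≤ 2 := by
  classical
  have h1 := h.2.2.2.listDeg_add x
  have h2 := List.nodup_iff_count_le_one.mp h.1 x
  have h3 := deg_setOf_mem_list_le es x
  simp only [List.count_cons, List.count_append, List.count_nil] at h1 h2
  simp [Ne.symm hx] at h1 h2
  omega

section Degree

lemma mem_vertsOf_of_deg_pos {F : Set G.E} {x : G.V} (h : 0 < G.deg F x) : x ∈ G.vertsOf F := by
  by_contra hx
  have h1 : {e ∈ F | x ∈ G.ends e} = ∅ := by
    ext e
    simp only [Set.mem_ofPred_eq, Set.mem_empty_iff_false, iff_false, not_and]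
    exact fun he hxe => hx ⟨e, he, hxe⟩
  have h2 : {e ∈ F | G.ends e = s(x, x)} = ∅ := by
    ext e
    simp only [Set.mem_ofPred_eq, Set.mem_empty_iff_false, iff_false, not_and]
    exact fun he hxe => hx ⟨e, he, by simp [hxe]⟩
  simp [deg, h1, h2] at h

lemma deg_pos_of_mem_vertsOf [Finite G.E] {F : Set G.E} {x : G.V} (h : x ∈ G.vertsOf F) :
    0 < G.deg F x := by
  obtain ⟨e, he, hx⟩ := h
  have : 0 < {e ∈ F | x ∈ G.ends e}.ncard := (Set.ncard_pos (Set.toFinite _)).mpr ⟨e, he, hx⟩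
  exact Nat.add_pos_left this _

lemma deg_union_le (F F' : Set G.E) (x : G.V) :
    G.deg (F ∪ F') x ≤ G.deg F x + G.deg F' x := by
  have key (p : G.E → Prop) :
      {e ∈ F ∪ F' | p e}.ncard ≤ {e ∈ F | p e}.ncard + {e ∈ F' | p e}.ncard := by
    rw [show {e ∈ F ∪ F' | p e} = {e ∈ F | p e} ∪ {e ∈ F' | p e} by
      ext e; simp [or_and_right]]
    exact Set.ncard_union_le _ _
  have h1 := key (fun e => x ∈ G.ends e)
  have h2 := key (fun e => G.ends e = s(x, x))
  simp only [deg]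
  omega

end Degree

section Chains

variable {r : G.V} {H Hb C : Set G.E} {v : G.V}

lemma IsMinimalUpChain.two_le_deg_and_deg_add_le [Finite G.E]
    (hC : G.IsMinimalUpChain r H Hb C) (hv : v ≠ r) (hH : G.deg H v ≤ 1)
    (hpos : 0 < G.deg C v) : 2 ≤ G.deg Hb v ∧ G.deg H v + G.deg C v ≤ 2 := by
  rcases hC with ⟨-, -, vs, es, hp, -, rfl, hdeg, -, -, hint⟩ |
    ⟨u, ⟨-, -, vs, es, hc, rfl, hdeg, hend⟩, hint⟩
  · have hmem := hp.2.2.mem_of_deg_pos hpos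
    refine ⟨(hdeg v hmem).resolve_left hv, ?_⟩
    by_cases hends : vs.head? = some v ∨ vs.getLast? = some v
    · have := hp.deg_end_le_one hends
      omega
    · push Not at hends
      have h0 : ¬ 0 < G.deg H v :=
        fun h => (hint v hmem hends.1 hends.2).2 (mem_vertsOf_of_deg_pos h)
      have := hp.deg_le_two v
      omega
  · have hmem := hc.mem_of_deg_pos hpos
    refine ⟨(hdeg v hmem).resolve_left hv, ?_⟩
    have hvu : v ≠ u := by
      rintro rfl
      have := hend.resolve_left hv
      omega
    have h0 : ¬ 0 < G.deg H v :=
      fun h => (hint v (mem_vertsOf_of_deg_pos hpos) hvu).2 (mem_vertsOf_of_deg_pos h)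
    have := hc.deg_le_two hvu
    omega

lemma IsMinimalDownChain.two_le_deg (hC : G.IsMinimalDownChain r H Hb C) (hv : v ≠ r)
    (hpos : 0 < G.deg C v) : 2 ≤ G.deg H v := by
  rcases hC with ⟨-, -, vs, es, hp, -, rfl, hdeg, -⟩ | ⟨u, ⟨-, -, vs, es, hc, rfl, hdeg, -⟩, -⟩
  · exact (hdeg v (hp.2.2.mem_of_deg_pos hpos)).resolve_left hv
  · exact (hdeg v (hc.mem_of_deg_pos hpos)).resolve_left hv

lemma IsOneWayChain.two_le_deg_and_deg_le_one (hC : G.IsOneWayChain r H Hb C) (hv : v ≠ r)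
    (hH : G.deg H v ≤ 1) (hpos : 0 < G.deg C v) : 2 ≤ G.deg Hb v ∧ G.deg C v ≤ 1 := by
  obtain ⟨a, b, e, -, -, rfl, he, ha, hb⟩ := hC
  have hav : a ≠ v := by
    rintro rfl
    have := ha.resolve_left hv
    omega
  have hset : ({e} : Set G.E) = {e' | e' ∈ [e]} := by ext; simp
  have hl : G.IsLink [a, b] [e] := ⟨he, trivial⟩
  rw [hset] at hpos ⊢
  have hmem := hl.mem_of_deg_pos hpos
  obtain rfl : v = b := by simpa [hav.symm] using hmem
  refine ⟨hb.resolve_left hv, IsPath.deg_end_le_one (vs := [a, v]) ⟨?_, ?_, hl⟩ (Or.inr rfl)⟩ <;>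
    simp [hav]

end Chains

section Decompositions

variable {r : G.V} {m : ℕ} {Gs : Fin (m + 1) → Set G.E} {v : G.V}

lemma IsMinimalChainDecomp.two_le_deg_after_and_deg_add_le [Finite G.E]
    (h : G.IsMinimalChainDecomp r Gs) (hv : v ≠ r) {i : Fin (m + 1)}
    (hH : G.deg (G.before Gs i) v ≤ 1) (hpos : 0 < G.deg (Gs i) v) :
    2 ≤ G.deg (G.after Gs i) v ∧ G.deg (G.before Gs i) v + G.deg (Gs i) v ≤ 2 := by
  rcases h.2 i with hu | hd | ho
  · exact hu.two_le_deg_and_deg_add_le hv hH hpos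
  · have := hd.two_le_deg hv hpos
    omega
  · have := ho.two_le_deg_and_deg_le_one hv hH hpos
    omega

lemma before_succ (Gs : Fin (m + 1) → Set G.E) (i : Fin m) :
    G.before Gs i.succ = G.before Gs i.castSucc ∪ Gs i.castSucc := by
  ext e
  simp only [before, Set.mem_ofPred_eq, Set.mem_union, ← Fin.le_castSucc_iff, le_iff_lt_or_eq,
    or_and_right, exists_or, exists_eq_left]

lemma IsMinimalChainDecomp.exists_deg_before_eq_two [Finite G.E] (hni : G.NoIsolated)
    (h : G.IsMinimalChainDecomp r Gs) (hv : v ≠ r) :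
    ∃ i, G.deg (G.before Gs i) v = 2 := by
  by_contra! hne
  have hle : ∀ i, G.deg (G.before Gs i) v ≤ 1 := by
    intro i
    induction i using Fin.induction with
    | zero =>
      rw [show G.before Gs 0 = ∅ by ext; simp [before]]
      simp [deg]
    | succ i ih =>
      have hne' := hne i.succ
      have hun := deg_union_le (G.before Gs i.castSucc) (Gs i.castSucc) v
      rw [← before_succ] at hun
      rcases Nat.eq_zero_or_pos (G.deg (Gs i.castSucc) v) with h0 | hpos
      · omega
      · have := h.two_le_deg_after_and_deg_add_le hv ih hpos
        omega
  obtain ⟨e, he⟩ := hni v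
  have hmem : e ∈ ⋃ i, Gs i := by
    rw [h.1.2.1]
    trivial
  obtain ⟨i₀, hi₀⟩ := Set.mem_iUnion.mp hmem
  obtain ⟨i, hi, hmax⟩ := Set.Finite.exists_maximal
    (Set.toFinite {i | 0 < G.deg (Gs i) v}) ⟨i₀, deg_pos_of_mem_vertsOf ⟨e, hi₀, he⟩⟩
  have hpos := (h.two_le_deg_after_and_deg_add_le hv (hle i) hi).1
  obtain ⟨f, ⟨j, hij, hf⟩, hvf⟩ := mem_vertsOf_of_deg_pos (by omega : 0 < G.deg (G.after Gs i) v)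
  exact absurd (hmax (deg_pos_of_mem_vertsOf ⟨f, hf, hvf⟩) hij.le) hij.not_ge

lemma before_comp_rev (Gs : Fin (m + 1) → Set G.E) (i : Fin (m + 1)) :
    G.before (Gs ∘ Fin.rev) i = G.after Gs i.rev := by
  ext e
  simp only [before, after, Set.mem_ofPred_eq, Function.comp_apply]
  rw [Fin.rev_surjective.exists]
  simp [Fin.rev_lt_iff]

lemma after_comp_rev (Gs : Fin (m + 1) → Set G.E) (i : Fin (m + 1)) :
    G.after (Gs ∘ Fin.rev) i = G.before Gs i.rev := by
  have := before_comp_rev (Gs ∘ Fin.rev) i.rev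
  rw [Fin.rev_rev] at this
  rw [← this]
  congr 1
  funext j
  simp

lemma IsOneWayChain.symm {H Hb C : Set G.E} (h : G.IsOneWayChain r H Hb C) :
    G.IsOneWayChain r Hb H C := by
  obtain ⟨a, b, e, h1, h2, hC, he, ha, hb⟩ := h
  exact ⟨b, a, e, h2, h1, hC, he.trans Sym2.eq_swap, hb, ha⟩

lemma IsMinimalChainDecomp.comp_rev (h : G.IsMinimalChainDecomp r Gs) :
    G.IsMinimalChainDecomp r (Gs ∘ Fin.rev) := by
  obtain ⟨⟨hdisj, hun, hch⟩, hmin⟩ := h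
  refine ⟨⟨fun i j hij => hdisj _ _ (Fin.rev_injective.ne hij), ?_, fun i => ?_⟩, fun i => ?_⟩
  · rw [← hun]
    exact Fin.rev_surjective.iUnion_comp Gs
  · rw [before_comp_rev, after_comp_rev]
    rcases hch i.rev with hu | hd | ho
    · exact Or.inr (Or.inl hu)
    · exact Or.inl hd
    · exact Or.inr (Or.inr ho.symm)
  · rw [before_comp_rev, after_comp_rev]
    rcases hmin i.rev with hu | hd | ho
    · exact Or.inr (Or.inl hu)
    · exact Or.inl hd
    · exact Or.inr (Or.inr ho.symm)

end Decompositions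

end MG

theorem degree_two_indices (G : MG) [Finite G.V] [Finite G.E]
    (hni : G.NoIsolated) (r : G.V) (m : ℕ) (Gs : Fin (m + 1) → Set G.E)
    (h : G.IsMinimalChainDecomp r Gs) (v : G.V) (hv : v ≠ r) :
    ∃ i j : Fin (m + 1), G.deg (G.before Gs i) v = 2 ∧ G.deg (G.after Gs j) v = 2 := by
  obtain ⟨i, hi⟩ := h.exists_deg_before_eq_two hni hv
  obtain ⟨j, hj⟩ := h.comp_rev.exists_deg_before_eq_two hni hv
  rw [MG.before_comp_rev] at hj
  exact ⟨i, j.rev, hi, hj⟩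
end

section
/- If a multigraph G has a chain decomposition rooted at a vertex r, then G has a minimal chain decomposition rooted at r. Indeed, every non-minimal up chain or down chain can be subdivided at the offending internal vertices into minimal chains, which are then inserted consecutively at the index of the old chain. -/
set_option autoImplicit false

namespace MG

variable {G : MG} {r : G.V} {H Hb H' Hb' C : Set G.E}

lemma vertsOf_mono (h : H ⊆ H') : G.vertsOf H ⊆ G.vertsOf H' :=
  fun _ ⟨e, he, hv⟩ => ⟨e, h he, hv⟩

lemma deg_mono [Finite G.E] (h : H ⊆ H') (v : G.V) : G.deg H v ≤ G.deg H' v :=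
  add_le_add
    (Set.ncard_le_ncard (fun _ he => ⟨h he.1, he.2⟩) (Set.toFinite _))
    (Set.ncard_le_ncard (fun _ he => ⟨h he.1, he.2⟩) (Set.toFinite _))

lemma mem_vertsOf_of_two_le_deg {v : G.V} (h : 2 ≤ G.deg H v) : v ∈ G.vertsOf H := by
  by_contra hv
  have h₁ : {e ∈ H | v ∈ G.ends e} = ∅ :=
    Set.eq_empty_of_forall_notMem fun e he => hv ⟨e, he⟩
  have h₂ : {e ∈ H | G.ends e = s(v, v)} = ∅ :=
    Set.eq_empty_of_forall_notMem fun e he => hv ⟨e, he.1, by simp [he.2]⟩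
  simp [deg, h₁, h₂] at h

/-! ### Monotonicity of chains -/

lemma IsOpenUpChain.mono [Finite G.E] (h : G.IsOpenUpChain r H Hb C)
    (hH : H ⊆ H') (hHb : Hb ⊆ Hb') (d : Disjoint C H') (d' : Disjoint C Hb') :
    G.IsOpenUpChain r H' Hb' C := by
  obtain ⟨-, -, vs, es, hp, hne, hC, hv, hh, hl⟩ := h
  exact ⟨d, d', vs, es, hp, hne, hC,
    fun v hvm => (hv v hvm).imp_right fun h => h.trans (deg_mono hHb v),
    fun v hvm => (hh v hvm).imp_right fun h => vertsOf_mono hH h,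
    fun v hvm => (hl v hvm).imp_right fun h => vertsOf_mono hH h⟩

lemma IsUpChain.mono [Finite G.E] (h : G.IsUpChain r H Hb C)
    (hH : H ⊆ H') (hHb : Hb ⊆ Hb') (d : Disjoint C H') (d' : Disjoint C Hb') :
    G.IsUpChain r H' Hb' C := by
  obtain h | ⟨v, -, -, vs, es, hc, hC, hv, hr⟩ := h
  · exact Or.inl (h.mono hH hHb d d')
  · exact Or.inr ⟨v, d, d', vs, es, hc, hC,
      fun u hu => (hv u hu).imp_right fun h => h.trans (deg_mono hHb u),
      hr.imp_right fun h => h.trans (deg_mono hH v)⟩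

lemma IsChain.mono [Finite G.E] (h : G.IsChain r H Hb C)
    (hH : H ⊆ H') (hHb : Hb ⊆ Hb') (d : Disjoint C H') (d' : Disjoint C Hb') :
    G.IsChain r H' Hb' C := by
  obtain h | h | ⟨u, v, e, -, -, rfl, he, hu, hv⟩ := h
  · exact Or.inl (h.mono hH hHb d d')
  · exact Or.inr (Or.inl (IsUpChain.mono h hHb hH d' d))
  · exact Or.inr (Or.inr ⟨u, v, e, Set.disjoint_singleton_left.1 d,
      Set.disjoint_singleton_left.1 d', rfl, he,
      hu.imp_right fun h => h.trans (deg_mono hH u),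
      hv.imp_right fun h => h.trans (deg_mono hHb v)⟩)

lemma IsUpChain.nonempty (h : G.IsUpChain r H Hb C) : C.Nonempty := by
  obtain ⟨-, -, vs, es, -, hne, rfl, -⟩ | ⟨v, -, -, vs, es, ⟨-, -, hne, -⟩, rfl, -⟩ := h <;>
  exact List.exists_mem_of_ne_nil es hne

lemma IsChain.nonempty (h : G.IsChain r H Hb C) : C.Nonempty := by
  obtain h | h | ⟨u, v, e, -, -, rfl, -⟩ := h
  · exact h.nonempty
  · exact IsUpChain.nonempty h
  · exact Set.singleton_nonempty e

/-! ### Subdividing a chain -/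

lemma IsLink.split {v : G.V} {bs : List G.V} : ∀ {as : List G.V} {es : List G.E},
    G.IsLink (as ++ v :: bs) es →
    ∃ es₁ es₂, es = es₁ ++ es₂ ∧ G.IsLink (as ++ [v]) es₁ ∧ G.IsLink (v :: bs) es₂
  | [], es, h => ⟨[], es, rfl, trivial, h⟩
  | [a], [], h => absurd h (by simp [IsLink])
  | [a], e :: es, h => ⟨[e], es, rfl, ⟨h.1, trivial⟩, h.2⟩
  | a :: b :: as, [], h => absurd h (by simp [IsLink])
  | a :: b :: as, e :: es, h => by
    obtain ⟨es₁, es₂, rfl, h₁, h₂⟩ := IsLink.split (as := b :: as) h.2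
    exact ⟨e :: es₁, es₂, rfl, ⟨h.1, h₁⟩, h₂⟩

lemma IsLink.mem_of_mem_ends {e : G.E} {u : G.V} : ∀ {vs : List G.V} {es : List G.E},
    G.IsLink vs es → e ∈ es → u ∈ G.ends e → u ∈ vs
  | [], _, h, _, _ => absurd h (by simp [IsLink])
  | [_], [], _, he, _ => absurd he (by simp)
  | [_], _ :: _, h, _, _ => absurd h (by simp [IsLink])
  | _ :: _ :: _, [], _, he, _ => absurd he (by simp)
  | a :: b :: vs, e' :: es, h, he, hu => by
    obtain rfl | he := List.mem_cons.1 he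
    · rw [h.1, Sym2.mem_iff] at hu
      obtain rfl | rfl := hu <;> simp
    · exact List.mem_cons_of_mem _ (IsLink.mem_of_mem_ends h.2 he hu)

/-- A linked sequence through an attachment vertex `v` splits into two open up chains. -/
lemma exists_openUpChain_split {a b v : G.V} {as bs : List G.V} {es : List G.E}
    (d : Disjoint {e | e ∈ es} H) (d' : Disjoint {e | e ∈ es} Hb) (hes : es.Nodup)
    (hl : G.IsLink ((a :: as) ++ v :: (bs ++ [b])) es)
    (h₁ : ((a :: as) ++ [v]).Nodup) (h₂ : (v :: (bs ++ [b])).Nodup)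
    (hd : ∀ u ∈ (a :: as) ++ v :: (bs ++ [b]), u = r ∨ 2 ≤ G.deg Hb u)
    (ha : a = r ∨ a ∈ G.vertsOf H) (hv : v = r ∨ v ∈ G.vertsOf H)
    (hb : b = r ∨ b ∈ G.vertsOf H) :
    ∃ C₁ C₂, C₁ ∪ C₂ = {e | e ∈ es} ∧ Disjoint C₁ C₂ ∧
      G.IsOpenUpChain r H Hb C₁ ∧ G.IsOpenUpChain r H Hb C₂ := by
  obtain ⟨es₁, es₂, rfl, hl₁, hl₂⟩ := hl.split
  have hs₁ : {e | e ∈ es₁} ⊆ {e | e ∈ es₁ ++ es₂} := fun e he => List.mem_append_left _ he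
  have hs₂ : {e | e ∈ es₂} ⊆ {e | e ∈ es₁ ++ es₂} := fun e he => List.mem_append_right _ he
  have hn := List.nodup_append'.1 hes
  have hne₁ : es₁ ≠ [] := by
    rintro rfl
    cases as <;> exact hl₁
  have hne₂ : es₂ ≠ [] := by
    rintro rfl
    cases bs <;> exact hl₂
  refine ⟨{e | e ∈ es₁}, {e | e ∈ es₂}, ?_, ?_,
    ⟨d.mono_left hs₁, d'.mono_left hs₁, (a :: as) ++ [v], es₁, ⟨h₁, hn.1, hl₁⟩, hne₁, rfl,
      fun u hu => hd u ?_, ?_, ?_⟩,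
    ⟨d.mono_left hs₂, d'.mono_left hs₂, v :: (bs ++ [b]), es₂, ⟨h₂, hn.2.1, hl₂⟩, hne₂, rfl,
      fun u hu => hd u (List.mem_append_right _ hu), ?_, ?_⟩⟩
  · ext e
    simp
  · exact Set.disjoint_left.2 fun e he he' => hn.2.2 he he'
  · simp only [List.mem_append, List.mem_cons, List.not_mem_nil, or_false] at hu ⊢
    tauto
  · intro u hu
    obtain rfl : a = u := by simpa using hu
    exact ha
  · intro u hu
    obtain rfl : v = u := by simpa [List.getLast?_cons] using hu
    exact hv
  · intro u hu
    obtain rfl : v = u := by simpa using hu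
    exact hv
  · intro u hu
    obtain rfl : b = u := by simpa [List.getLast?_cons] using hu
    exact hb

lemma IsUpChain.exists_split_of_not_minimal (h : G.IsUpChain r H Hb C)
    (hm : ¬ G.IsMinimalUpChain r H Hb C) :
    ∃ C₁ C₂, C₁ ∪ C₂ = C ∧ Disjoint C₁ C₂ ∧
      G.IsOpenUpChain r H Hb C₁ ∧ G.IsOpenUpChain r H Hb C₂ := by
  obtain ⟨d, d', vs, es, hp, hne, rfl, hd, hh, hla⟩ | ⟨v, hc⟩ := h
  · obtain ⟨v, hv, hvh, hvl, hvr⟩ : ∃ v ∈ vs, vs.head? ≠ some v ∧ vs.getLast? ≠ some v ∧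
        (v = r ∨ v ∈ G.vertsOf H) := by
      by_contra! hcon
      exact hm (Or.inl ⟨d, d', vs, es, hp, hne, rfl, hd, hh, hla,
        fun v hv h₁ h₂ => hcon v hv h₁ h₂⟩)
    obtain ⟨as, bs, rfl⟩ := List.append_of_mem hv
    obtain _ | ⟨a, as⟩ := as
    · simp at hvh
    obtain rfl | ⟨bs, b, rfl⟩ := List.eq_nil_or_concat' bs
    · exact absurd List.getLast?_concat hvl
    refine exists_openUpChain_split d d' hp.2.1 hp.2.2 ?_ ?_ hd (hh a (by simp)) hvr
      (hla b (by simp [List.getLast?_cons]))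
    · exact hp.1.sublist (List.Sublist.append_left (by simp) _)
    · exact hp.1.sublist (List.sublist_append_right _ _)
  · obtain ⟨u, hu, huv, hur⟩ : ∃ u ∈ G.vertsOf C, u ≠ v ∧ (u = r ∨ u ∈ G.vertsOf H) := by
      by_contra! hcon
      exact hm (Or.inr ⟨v, hc, fun u hu huv => hcon u hu huv⟩)
    obtain ⟨d, d', vs, es, ⟨hn, hes, -, hl⟩, rfl, hd, hv⟩ := hc
    obtain ⟨e, he, hue⟩ := hu
    have hmem : u ∈ vs := by
      simpa [huv] using hl.mem_of_mem_ends he hue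
    obtain ⟨as, bs, rfl⟩ := List.append_of_mem hmem
    have hv' : v = r ∨ v ∈ G.vertsOf H := hv.imp_right mem_vertsOf_of_two_le_deg
    refine exists_openUpChain_split (as := as) (bs := bs) d d' hes (by simpa using hl) ?_ ?_ ?_
      hv' hur hv'
    · exact hn.sublist ((List.Sublist.append_left (by simp) as).cons_cons v)
    · grind
    · intro w hw
      refine hd w ?_
      simp only [List.mem_append, List.mem_cons, List.not_mem_nil, or_false] at hw ⊢
      tauto

/-! ### Refining a decomposition -/

section Decomposition

variable {n : ℕ} {Gs : Fin n → Set G.E}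

lemma IsChainDecomp.le_card [Finite G.E] (h : G.IsChainDecomp r Gs) : n ≤ Nat.card G.E := by
  choose f hf using fun i => (h.2.2 i).nonempty
  have hinj : Function.Injective f := by
    intro i j hij
    by_contra hne
    exact Set.disjoint_left.1 (h.1 i j hne) (hf i) (hij ▸ hf j)
  simpa using Nat.card_le_card_of_injective f hinj

/-- Replace the `i`-th term of `Gs` by the two consecutive terms `C₁`, `C₂`. -/
def splitAt (Gs : Fin n → Set G.E) (i : Fin n) (C₁ C₂ : Set G.E) (k : Fin (n + 1)) : Set G.E :=
  if k = i.castSucc then C₁ else if k = i.succ then C₂ else Gs (i.predAbove k)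

variable {i : Fin n} {C₁ C₂ : Set G.E}

lemma splitAt_castSucc : splitAt Gs i C₁ C₂ i.castSucc = C₁ := by
  simp [splitAt]

lemma splitAt_succ : splitAt Gs i C₁ C₂ i.succ = C₂ := by
  simp [splitAt, Fin.ext_iff]

lemma splitAt_of_ne {k : Fin (n + 1)} (h₁ : k ≠ i.castSucc) (h₂ : k ≠ i.succ) :
    splitAt Gs i C₁ C₂ k = Gs (i.predAbove k) := by
  simp [splitAt, h₁, h₂]

lemma splitAt_subset (hC : C₁ ∪ C₂ = Gs i) (k : Fin (n + 1)) :
    splitAt Gs i C₁ C₂ k ⊆ Gs (i.predAbove k) := by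
  unfold splitAt
  split_ifs with h₁ h₂
  · subst h₁
    simp [← hC]
  · subst h₂
    simp [← hC]
  · rfl

lemma exists_mem_splitAt (hC : C₁ ∪ C₂ = Gs i) {j : Fin n} {e : G.E} (he : e ∈ Gs j) :
    ∃ k, i.predAbove k = j ∧ e ∈ splitAt Gs i C₁ C₂ k := by
  by_cases hj : j = i
  · subst hj
    rw [← hC] at he
    obtain he | he := he
    · exact ⟨j.castSucc, by simp, by rwa [splitAt_castSucc]⟩
    · exact ⟨j.succ, by simp, by rwa [splitAt_succ]⟩
  · obtain ⟨k, rfl⟩ := Fin.predAbove_surjective i j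
    refine ⟨k, rfl, ?_⟩
    rwa [splitAt_of_ne] <;> rintro rfl <;> simp at hj

lemma before_subset_before_splitAt (hC : C₁ ∪ C₂ = Gs i) (k : Fin (n + 1)) :
    G.before Gs (i.predAbove k) ⊆ G.before (splitAt Gs i C₁ C₂) k := by
  rintro e ⟨j, hj, he⟩
  obtain ⟨l, rfl, hl⟩ := exists_mem_splitAt hC he
  exact ⟨l, (Fin.predAbove_right_monotone i).reflect_lt hj, hl⟩

lemma after_subset_after_splitAt (hC : C₁ ∪ C₂ = Gs i) (k : Fin (n + 1)) :
    G.after Gs (i.predAbove k) ⊆ G.after (splitAt Gs i C₁ C₂) k := by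
  rintro e ⟨j, hj, he⟩
  obtain ⟨l, rfl, hl⟩ := exists_mem_splitAt hC he
  exact ⟨l, (Fin.predAbove_right_monotone i).reflect_lt hj, hl⟩

lemma disjoint_splitAt (hd : ∀ i j, i ≠ j → Disjoint (Gs i) (Gs j)) (hC : C₁ ∪ C₂ = Gs i)
    (hC' : Disjoint C₁ C₂) (k l : Fin (n + 1)) (hkl : k ≠ l) :
    Disjoint (splitAt Gs i C₁ C₂ k) (splitAt Gs i C₁ C₂ l) := by
  by_cases hp : i.predAbove k = i.predAbove l
  · have hcases : (k = i.castSucc ∧ l = i.succ) ∨ (k = i.succ ∧ l = i.castSucc) := by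
      unfold Fin.predAbove at hp
      split_ifs at hp <;>
      simp only [Fin.ext_iff, Fin.val_pred, Fin.coe_castPred] at hp <;>
      simp only [Fin.lt_def, Fin.ext_iff, Fin.val_castSucc, Fin.val_succ] at * <;>
      omega
    obtain ⟨rfl, rfl⟩ | ⟨rfl, rfl⟩ := hcases
    · rwa [splitAt_castSucc, splitAt_succ]
    · rw [splitAt_castSucc, splitAt_succ]
      exact hC'.symm
  · exact (hd _ _ hp).mono (splitAt_subset hC k) (splitAt_subset hC l)

lemma IsChainDecomp.splitAt [Finite G.E] (h : G.IsChainDecomp r Gs) (hC : C₁ ∪ C₂ = Gs i)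
    (hC' : Disjoint C₁ C₂) (h₁ : G.IsChain r (G.before Gs i) (G.after Gs i) C₁)
    (h₂ : G.IsChain r (G.before Gs i) (G.after Gs i) C₂) :
    G.IsChainDecomp r (splitAt Gs i C₁ C₂) := by
  have hd := disjoint_splitAt h.1 hC hC'
  refine ⟨hd, ?_, fun k => ?_⟩
  · refine Set.eq_univ_of_forall fun e => ?_
    obtain ⟨j, hj⟩ := Set.mem_iUnion.1 (h.2.1 ▸ Set.mem_univ e : e ∈ ⋃ i, Gs i)
    obtain ⟨k, -, hk⟩ := exists_mem_splitAt hC hj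
    exact Set.mem_iUnion.2 ⟨k, hk⟩
  · have hchain : G.IsChain r (G.before Gs (i.predAbove k)) (G.after Gs (i.predAbove k))
        (MG.splitAt Gs i C₁ C₂ k) := by
      by_cases hk₁ : k = i.castSucc
      · subst hk₁
        rwa [splitAt_castSucc, Fin.predAbove_castSucc_self]
      by_cases hk₂ : k = i.succ
      · subst hk₂
        rwa [splitAt_succ, Fin.predAbove_succ_self]
      rw [splitAt_of_ne hk₁ hk₂]
      exact h.2.2 _
    refine hchain.mono (before_subset_before_splitAt hC k) (after_subset_after_splitAt hC k)
      (Set.disjoint_left.2 ?_) (Set.disjoint_left.2 ?_)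
    · rintro e he ⟨j, hj, he'⟩
      exact Set.disjoint_left.1 (hd k j hj.ne') he he'
    · rintro e he ⟨j, hj, he'⟩
      exact Set.disjoint_left.1 (hd k j hj.ne) he he'

lemma IsChainDecomp.exists_refinement [Finite G.E] (h : G.IsChainDecomp r Gs)
    (hm : ¬ G.IsMinimalChainDecomp r Gs) :
    ∃ Gs' : Fin (n + 1) → Set G.E, G.IsChainDecomp r Gs' := by
  obtain ⟨i, hi⟩ := not_forall.1 fun hall => hm ⟨h, hall⟩
  push Not at hi
  obtain ⟨hup, hdown, hone⟩ := hi
  obtain hc | hc | hc := h.2.2 i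
  · obtain ⟨C₁, C₂, hC, hC', h₁, h₂⟩ := hc.exists_split_of_not_minimal hup
    exact ⟨_, h.splitAt hC hC' (Or.inl (Or.inl h₁)) (Or.inl (Or.inl h₂))⟩
  · obtain ⟨C₁, C₂, hC, hC', h₁, h₂⟩ := IsUpChain.exists_split_of_not_minimal hc hdown
    exact ⟨_, h.splitAt hC hC' (Or.inr (Or.inl (Or.inl h₁))) (Or.inr (Or.inl (Or.inl h₂)))⟩
  · exact absurd hc hone

end Decomposition

end MG

theorem exists_minimal_chain_decomp (G : MG) [Finite G.V] [Finite G.E]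
    (r : G.V) (h : G.HasChainDecomp r) :
    ∃ (m : ℕ) (Gs : Fin (m + 1) → Set G.E), G.IsMinimalChainDecomp r Gs := by
  by_contra hcon
  have hlong : ∀ k : ℕ, ∃ m, k ≤ m ∧ ∃ Gs : Fin (m + 1) → Set G.E, G.IsChainDecomp r Gs := by
    intro k
    induction k with
    | zero =>
      obtain ⟨m, Gs, hGs⟩ := h
      exact ⟨m, m.zero_le, Gs, hGs⟩
    | succ k ih =>
      obtain ⟨m, hm, Gs, hGs⟩ := ih
      exact ⟨m + 1, by omega, hGs.exists_refinement fun hmin => hcon ⟨m, Gs, hmin⟩⟩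
  obtain ⟨m, hm, Gs, hGs⟩ := hlong (Nat.card G.E)
  have := hGs.le_card
  omega
end
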